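/- Sufficiency of the Lambert-W condition with an optimally tuned power e-calibrator: Fix δ ∈ (0,1), integers 1 ≤ M ≤ K with δM/K < 1, positive integers n_k^eval ≤ n_k, and let w be the unique real number w ≤ −1 satisfying w e^w = −δM/(eK). If n_k^eval / n_k < log(2K/(δM)) / (log 2 − w), then there exists τ ∈ (0,1) (namely the parameter maximizing f_τ at the point p* = e^w, at which sup_{τ'∈(0,1)} f_{τ'}(p*) = K/(δM)) such that the PS-DME band width sqrt((1/(2 n_k)) · log(2 / f_τ^{-1}(K/(δM)))) is strictly smaller than the SS-DME band width sqrt((1/(2 n_k^eval)) · log(2K/(δM))). Here M plays the role of a fixed (non-data-dependent) selected-set size |𝒦|. -/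

import Mathlib

open MeasureTheory

/-- The power-family e-calibrator `f_τ(p) = (1−τ) p^{−τ}` for `p ∈ (0,1]`
(extended by `∞` at `p ≤ 0`). -/
noncomputable def powCal (τ : ℝ) : ℝ → ENNReal := fun p =>
  if p ≤ 0 then ⊤ else ENNReal.ofReal ((1 - τ) * p ^ (-τ))

/-- Generalized inverse of an e-calibrator: `f⁻¹(t) = sup {u ∈ [0,1] : f(u) ≥ t}`. -/
noncomputable def ecalInv (f : ℝ → ENNReal) (t : ENNReal) : ℝ :=
  sSup {u | u ∈ Set.Icc (0:ℝ) 1 ∧ t ≤ f u}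

/-- Evaluating the generalized inverse of `f_τ` at the value `f_τ(p)` gives back `p`. -/
theorem ecalInv_powCal {τ p : ℝ} (hτ : τ ∈ Set.Ioo (0:ℝ) 1) (hp : p ∈ Set.Ioc (0:ℝ) 1) :
    ecalInv (powCal τ) (ENNReal.ofReal ((1 - τ) * p ^ (-τ))) = p := by
  obtain ⟨h0, h1⟩ := hτ
  obtain ⟨hp0, hp1⟩ := hp
  refine IsGreatest.csSup_eq ⟨⟨⟨hp0.le, hp1⟩, ?_⟩, ?_⟩
  · simp [powCal, hp0.not_ge]
  · rintro u ⟨-, hu⟩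
    by_contra! hlt
    have hu0 : 0 < u := hp0.trans hlt
    rw [powCal, if_neg hu0.not_ge, ENNReal.ofReal_le_ofReal_iff
      (mul_nonneg (by linarith) (Real.rpow_nonneg hu0.le _))] at hu
    have hpow : u ^ (-τ) < p ^ (-τ) := Real.rpow_lt_rpow_of_neg hp0 hlt (by linarith)
    exact absurd hu (mul_lt_mul_of_pos_left hpow (by linarith)).not_ge

/-- For `w < 0`, the map `τ ↦ (1 - τ) (e^w)^{-τ}` is bounded by `e^{-w-1} / (-w)`. -/
theorem one_sub_mul_exp_rpow_neg_le {w : ℝ} (hw : w < 0) (τ : ℝ) :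
    (1 - τ) * Real.exp w ^ (-τ) ≤ Real.exp (-w - 1) / (-w) := by
  have h := Real.add_one_le_exp (-w * (1 - τ) - 1)
  rw [le_div_iff₀ (by linarith), ← Real.exp_mul]
  calc (1 - τ) * Real.exp (w * -τ) * -w = (-w * (1 - τ) - 1 + 1) * Real.exp (w * -τ) := by ring
    _ ≤ Real.exp (-w * (1 - τ) - 1) * Real.exp (w * -τ) := by gcongr
    _ = Real.exp (-w - 1) := by rw [← Real.exp_add]; ring_nf

/-- For `w < 0`, the bound `e^{-w-1} / (-w)` is attained at `τ = 1 + 1/w`. -/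
theorem one_sub_mul_exp_rpow_neg_eq {w : ℝ} (hw : w < 0) :
    (1 - (1 + 1 / w)) * Real.exp w ^ (-(1 + 1 / w)) = Real.exp (-w - 1) / (-w) := by
  have hw' : w ≠ 0 := hw.ne
  have h : w * -(1 + 1 / w) = -w - 1 := by field_simp; ring
  rw [← Real.exp_mul, h]
  field_simp
  ring

/-- **Sufficiency of the Lambert-W condition with an optimally tuned power
e-calibrator.**  Let `δ ∈ (0,1)`, `1 ≤ M ≤ K` with `δM/K < 1` (here `M` is a fixed,
non-data-dependent selected-set size), positive sample sizes `n_k^eval ≤ n_k`, and let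
`w ≤ −1` satisfy `w e^w = −δM/(eK)`.  If
`n_k^eval / n_k < log(2K/(δM)) / (log 2 − w)`, then there is `τ ∈ (0,1)` — namely the
parameter maximizing `τ' ↦ f_{τ'}(p*)` over `(0,1)` at the point `p* = e^w`, at which
the maximal value equals `K/(δM)` — such that the PS-DME band width
`sqrt((1/(2 n_k)) log(2 / f_τ⁻¹(K/(δM))))` is strictly smaller than the SS-DME band
width `sqrt((1/(2 n_k^eval)) log(2K/(δM)))`. -/
theorem psdme_power_calibrator_sufficient_condition
    (δ : ℝ) (hδ : δ ∈ Set.Ioo (0:ℝ) 1)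
    (K M : ℕ) (hM : 1 ≤ M) (hMK : M ≤ K)
    (hratio : δ * (M : ℝ) / (K : ℝ) < 1)
    (nk nkeval : ℕ) (hnkeval : 0 < nkeval) (hle : nkeval ≤ nk)
    (w : ℝ) (hw : w ≤ -1)
    (hwe : w * Real.exp w = -(δ * (M : ℝ)) / (Real.exp 1 * (K : ℝ)))
    (hcond : (nkeval : ℝ) / (nk : ℝ)
      < Real.log ((2 * (K : ℝ)) / (δ * (M : ℝ))) / (Real.log 2 - w)) :
    ∃ τ ∈ Set.Ioo (0:ℝ) 1,
      -- τ maximizes τ' ↦ (1−τ') (p*)^{−τ'} over (0,1) at p* = e^w ...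
      (∀ τ' ∈ Set.Ioo (0:ℝ) 1,
        (1 - τ') * (Real.exp w) ^ (-τ') ≤ (1 - τ) * (Real.exp w) ^ (-τ)) ∧
      -- ... and the maximal value there equals K/(δM)
      (1 - τ) * (Real.exp w) ^ (-τ) = (K : ℝ) / (δ * (M : ℝ)) ∧
      -- PS-DME band width is strictly smaller than SS-DME band width
      Real.sqrt ((1 / (2 * (nk : ℝ))) *
          Real.log (2 / ecalInv (powCal τ) (ENNReal.ofReal ((K : ℝ) / (δ * (M : ℝ))))))
        < Real.sqrt ((1 / (2 * (nkeval : ℝ))) *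
            Real.log ((2 * (K : ℝ)) / (δ * (M : ℝ)))) := by
  obtain ⟨hδ0, -⟩ := hδ
  have hM0 : (0:ℝ) < M := by exact_mod_cast hM
  have hK0 : (0:ℝ) < K := by exact_mod_cast hM.trans hMK
  have hδM : 0 < δ * (M:ℝ) := mul_pos hδ0 hM0
  have hnke : (0:ℝ) < nkeval := by exact_mod_cast hnkeval
  have hnk : (0:ℝ) < nk := by exact_mod_cast hnkeval.trans_le hle
  have hw0 : w < 0 := by linarith
  have hw1 : w < -1 := by
    refine lt_of_le_of_ne hw fun h => ?_
    subst h
    rw [Real.exp_neg] at hwe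
    have he := Real.exp_pos 1
    field_simp at hwe
    rw [div_lt_one hK0] at hratio
    linarith
  have hval : Real.exp (-w - 1) / (-w) = (K:ℝ) / (δ * M) := by
    have he := Real.exp_pos 1
    have hew := Real.exp_pos w
    have hw' : -w ≠ 0 := by linarith
    rw [Real.exp_sub, Real.exp_neg, div_eq_div_iff hw' hδM.ne']
    field_simp at hwe ⊢
    linarith
  have hmax := one_sub_mul_exp_rpow_neg_eq hw0
  have hτ : 1 + 1 / w ∈ Set.Ioo (0:ℝ) 1 := by
    have h1 : 1 / w < 0 := one_div_neg.mpr hw0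
    have h2 : -1 < 1 / w := by rw [lt_div_iff_of_neg hw0]; linarith
    exact ⟨by linarith, by linarith⟩
  refine ⟨1 + 1 / w, hτ, fun τ' _ => (one_sub_mul_exp_rpow_neg_le hw0 τ').trans_eq hmax.symm,
    hmax.trans hval, ?_⟩
  have hlog2 : 0 < Real.log 2 := Real.log_pos one_lt_two
  rw [← hmax.trans hval, ecalInv_powCal hτ ⟨Real.exp_pos w, Real.exp_le_one_iff.mpr hw0.le⟩,
    Real.log_div two_ne_zero (Real.exp_pos w).ne', Real.log_exp]
  rw [div_lt_div_iff₀ hnk (by linarith)] at hcond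
  refine Real.sqrt_lt_sqrt (mul_nonneg (by positivity) (by linarith)) ?_
  rw [one_div_mul_eq_div, one_div_mul_eq_div, div_lt_div_iff₀ (by positivity) (by positivity)]
  linarith
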